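/- Let p ∈ [1, ∞) and let 𝐗 and 𝐘 be Effros-measurable maps from Ω to nonempty closed subsets of ℝ^d, each possessing at least one p-integrable selection. Then the set of p-integrable selections of the closed sum 𝐗 ⊞ 𝐘 equals the closure, in the L^p(Ω; ℝ^d) norm, of the set {ξ + η : ξ ∈ L^p(𝐗), η ∈ L^p(𝐘)}. -/

import Mathlib

open MeasureTheory Set Filter
open scoped Pointwise ENNReal

noncomputable section

/-- `ℝ^d` with the Euclidean norm. -/
abbrev Vec (d : ℕ) := EuclideanSpace ℝ (Fin d)

/-- Effros measurability of a set-valued map: `{ω : X(ω) ∩ G ≠ ∅}` is measurable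
for every open `G`. -/
def EffrosMeasurable {Ω : Type*} [MeasurableSpace Ω] {d : ℕ} (X : Ω → Set (Vec d)) : Prop :=
  ∀ G : Set (Vec d), IsOpen G → MeasurableSet {ω | (X ω ∩ G).Nonempty}

/-- The family of `p`-integrable selections of a set-valued map `X`, viewed as a
subset of the Lebesgue space `L^p(Ω; ℝ^d)`. -/
def lpSelections {Ω : Type*} [MeasurableSpace Ω] (μ : Measure Ω) (p : ℝ≥0∞) [Fact (1 ≤ p)]
    {d : ℕ} (X : Ω → Set (Vec d)) : Set (Lp (Vec d) p μ) :=
  {f | ∀ᵐ ω ∂μ, f ω ∈ X ω}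

/-- Intersecting an Effros-measurable map with a measurably chosen member of a sequence of open
sets preserves Effros measurability. -/
lemma EffrosMeasurable.inter_open {Ω : Type*} [MeasurableSpace Ω] {d : ℕ} {X : Ω → Set (Vec d)}
    (hX : EffrosMeasurable X) {i : Ω → ℕ} (hi : Measurable i) {U : ℕ → Set (Vec d)}
    (hU : ∀ k, IsOpen (U k)) : EffrosMeasurable (fun ω => X ω ∩ U (i ω)) := by
  intro G hG
  have h : {ω | (X ω ∩ U (i ω) ∩ G).Nonempty} =
      ⋃ k, (i ⁻¹' {k} ∩ {ω | (X ω ∩ (U k ∩ G)).Nonempty}) := by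
    ext ω
    simp [inter_assoc]
  rw [h]
  exact MeasurableSet.iUnion fun k =>
    (hi (measurableSet_singleton k)).inter (hX _ ((hU k).inter hG))

/-- An Effros-measurable map with nonempty values can be localized measurably to balls of any
given radius centred on a dense sequence. -/
lemma EffrosMeasurable.exists_measurable_index {Ω : Type*} [MeasurableSpace Ω] {d : ℕ}
    {X : Ω → Set (Vec d)} (hX : EffrosMeasurable X) (hne : ∀ ω, (X ω).Nonempty) {ε : ℝ}
    (hε : 0 < ε) :
    ∃ i : Ω → ℕ, Measurable i ∧
      ∀ ω, (X ω ∩ Metric.ball (TopologicalSpace.denseSeq (Vec d) (i ω)) ε).Nonempty := by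
  classical
  have hex : ∀ ω, ∃ k,
      (X ω ∩ Metric.ball (TopologicalSpace.denseSeq (Vec d) k) ε).Nonempty := by
    intro ω
    obtain ⟨x, hx⟩ := hne ω
    obtain ⟨k, hk⟩ := (TopologicalSpace.denseRange_denseSeq (Vec d)).exists_dist_lt x hε
    exact ⟨k, x, hx, hk⟩
  exact ⟨fun ω => Nat.find (hex ω), measurable_find hex fun k => hX _ Metric.isOpen_ball,
    fun ω => Nat.find_spec (hex ω)⟩

/-- **Kuratowski–Ryll-Nardzewski selection theorem** in Euclidean space. -/
theorem EffrosMeasurable.exists_measurable_selection {Ω : Type*} [MeasurableSpace Ω] {d : ℕ}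
    {X : Ω → Set (Vec d)} (hX : EffrosMeasurable X) (hne : ∀ ω, (X ω).Nonempty) :
    ∃ f : Ω → Vec d, Measurable f ∧ ∀ ω, f ω ∈ closure (X ω) := by
  let q := TopologicalSpace.denseSeq (Vec d)
  let S := {W : Ω → Set (Vec d) // EffrosMeasurable W ∧ ∀ ω, (W ω).Nonempty}
  have hpos : ∀ n : ℕ, (0 : ℝ) < (1 / 2) ^ n := fun n => by positivity
  have step : ∀ (n : ℕ) (W : S), ∃ i : Ω → ℕ, Measurable i ∧
      ∀ ω, (W.1 ω ∩ Metric.ball (q (i ω)) ((1 / 2) ^ n)).Nonempty := fun n W =>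
    W.2.1.exists_measurable_index W.2.2 (hpos n)
  choose i him hi using step
  let next : ℕ → S → S := fun n W =>
    ⟨fun ω => W.1 ω ∩ Metric.ball (q (i n W ω)) ((1 / 2) ^ n),
      W.2.1.inter_open (U := fun k => Metric.ball (q k) ((1 / 2) ^ n)) (him n W)
        fun _ => Metric.isOpen_ball, hi n W⟩
  let W : ℕ → S := fun n => Nat.rec ⟨X, hX, hne⟩ next n
  let f : ℕ → Ω → Vec d := fun n ω => q (i n (W n) ω)
  have hW : ∀ n ω, (W (n + 1)).1 ω = (W n).1 ω ∩ Metric.ball (f n ω) ((1 / 2) ^ n) :=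
    fun _ _ => rfl
  have hWX : ∀ n ω, (W n).1 ω ⊆ X ω := by
    intro n ω
    induction n with
    | zero => exact subset_rfl
    | succ n ih => rw [hW]; exact inter_subset_left.trans ih
  have hfm : ∀ n, Measurable (f n) := fun n => measurable_from_nat.comp (him n (W n))
  have hdist : ∀ ω n, dist (f n ω) (f (n + 1) ω) ≤ 2 * (1 / 2) ^ n := by
    intro ω n
    obtain ⟨w, hw⟩ := (W (n + 2)).2.2 ω
    rw [hW (n + 1), hW n] at hw
    have h₁ := Metric.mem_ball'.1 hw.1.2
    have h₂ := Metric.mem_ball.1 hw.2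
    have h₃ := dist_triangle (f n ω) w (f (n + 1) ω)
    have h₄ := hpos n
    rw [pow_succ] at h₂
    linarith
  have hlim : ∀ ω, ∃ y, Tendsto (fun n => f n ω) atTop (nhds y) := fun ω =>
    cauchySeq_tendsto_of_complete (cauchySeq_of_le_geometric _ _ (by norm_num) (hdist ω))
  choose g hg using hlim
  refine ⟨g, measurable_of_tendsto_metrizable hfm (tendsto_pi_nhds.2 hg), fun ω => ?_⟩
  choose w hw using fun n => (W (n + 1)).2.2 ω
  have hwg : Tendsto w atTop (nhds (g ω)) := by
    refine (hg ω).congr_dist ?_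
    refine squeeze_zero (fun _ => dist_nonneg) (fun n => ?_)
      (tendsto_pow_atTop_nhds_zero_of_lt_one (r := (1 / 2 : ℝ)) (by norm_num) (by norm_num))
    have h := hw n
    rw [hW] at h
    exact (Metric.mem_ball'.1 h.2).le
  exact mem_closure_of_tendsto hwg (Eventually.of_forall fun n => hWX (n + 1) ω (hw n))

/-- A measurable selection of a closed sum is uniformly approximated by sums of measurable
selections. -/
lemma exists_measurable_selections_near {Ω : Type*} [MeasurableSpace Ω] {μ : Measure Ω} {d : ℕ}
    {X Y : Ω → Set (Vec d)} (hXm : EffrosMeasurable X) (hYm : EffrosMeasurable Y)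
    (hXne : ∀ ω, (X ω).Nonempty) (hYne : ∀ ω, (Y ω).Nonempty)
    (hXcl : ∀ ω, IsClosed (X ω)) (hYcl : ∀ ω, IsClosed (Y ω))
    {ζ : Ω → Vec d} (hζm : Measurable ζ) (hζ : ∀ᵐ ω ∂μ, ζ ω ∈ closure (X ω + Y ω))
    {δ : ℝ} (hδ : 0 < δ) :
    ∃ ξ η : Ω → Vec d, Measurable ξ ∧ Measurable η ∧ (∀ ω, ξ ω ∈ X ω) ∧ (∀ ω, η ω ∈ Y ω) ∧
      ∀ᵐ ω ∂μ, ‖ζ ω - (ξ ω + η ω)‖ ≤ 5 * δ := by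
  classical
  let q := TopologicalSpace.denseSeq (Vec d)
  have hq : ∀ x, ∃ k, dist x (q k) < δ := fun x =>
    (TopologicalSpace.denseRange_denseSeq (Vec d)).exists_dist_lt x hδ
  let N := toMeasurable μ {ω | ¬ ζ ω ∈ closure (X ω + Y ω)}
  have hN : ∀ᵐ ω ∂μ, ω ∉ N := measure_eq_zero_iff_ae_notMem.1 <| by
    rw [measure_toMeasurable]; exact ae_iff.1 hζ
  have hNm : MeasurableSet N := measurableSet_toMeasurable _ _
  let P : Ω → ℕ → Prop := fun ω k =>
    (X ω ∩ Metric.ball (q k.unpair.1) δ).Nonempty ∧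
    (Y ω ∩ Metric.ball (q k.unpair.2) δ).Nonempty ∧
    (ω ∈ N ∨ dist (ζ ω) (q k.unpair.1 + q k.unpair.2) < 3 * δ)
  have hP : ∀ ω, ∃ k, P ω k := by
    intro ω
    have hxy : ∃ x ∈ X ω, ∃ y ∈ Y ω, ω ∈ N ∨ dist (ζ ω) (x + y) < δ := by
      by_cases hω : ω ∈ N
      · obtain ⟨x, hx⟩ := hXne ω
        obtain ⟨y, hy⟩ := hYne ω
        exact ⟨x, hx, y, hy, Or.inl hω⟩
      · have hmem : ζ ω ∈ closure (X ω + Y ω) := by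
          by_contra h
          exact hω (subset_toMeasurable _ _ h)
        obtain ⟨z, ⟨x, hx, y, hy, rfl⟩, hz⟩ := Metric.mem_closure_iff.1 hmem δ hδ
        exact ⟨x, hx, y, hy, Or.inr hz⟩
    obtain ⟨x, hx, y, hy, h⟩ := hxy
    obtain ⟨i, hi⟩ := hq x
    obtain ⟨j, hj⟩ := hq y
    refine ⟨Nat.pair i j, ?_⟩
    simp only [P, Nat.unpair_pair]
    refine ⟨⟨x, hx, hi⟩, ⟨y, hy, hj⟩, h.imp_right fun h => ?_⟩
    have h₁ := dist_triangle (ζ ω) (x + y) (q i + q j)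
    have h₂ := dist_add_add_le x y (q i) (q j)
    linarith
  have hkm : Measurable fun ω => Nat.find (hP ω) :=
    measurable_find hP fun k => (hXm _ Metric.isOpen_ball).inter
      ((hYm _ Metric.isOpen_ball).inter
        (hNm.union (measurableSet_lt (hζm.dist measurable_const) measurable_const)))
  have hk := fun ω => Nat.find_spec (hP ω)
  set k : Ω → ℕ := fun ω => Nat.find (hP ω)
  have hball : ∀ n, IsOpen (Metric.ball (q n) δ) := fun _ => Metric.isOpen_ball
  obtain ⟨ξ, hξm, hξ⟩ := (hXm.inter_open (i := fun ω => (k ω).unpair.1)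
    ((measurable_from_nat (f := fun m => m.unpair.1)).comp hkm) hball).exists_measurable_selection fun ω => (hk ω).1
  obtain ⟨η, hηm, hη⟩ := (hYm.inter_open (i := fun ω => (k ω).unpair.2)
    ((measurable_from_nat (f := fun m => m.unpair.2)).comp hkm) hball).exists_measurable_selection fun ω => (hk ω).2.1
  refine ⟨ξ, η, hξm, hηm, fun ω => closure_minimal inter_subset_left (hXcl ω) (hξ ω),
    fun ω => closure_minimal inter_subset_left (hYcl ω) (hη ω), ?_⟩
  filter_upwards [hN] with ω hω
  have hξd : dist (ξ ω) (q (k ω).unpair.1) ≤ δ :=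
    closure_minimal (inter_subset_right.trans Metric.ball_subset_closedBall)
      Metric.isClosed_closedBall (hξ ω)
  have hηd : dist (η ω) (q (k ω).unpair.2) ≤ δ :=
    closure_minimal (inter_subset_right.trans Metric.ball_subset_closedBall)
      Metric.isClosed_closedBall (hη ω)
  have hζd := (hk ω).2.2.resolve_left hω
  rw [← dist_eq_norm]
  have h₁ := dist_triangle_right (ζ ω) (ξ ω + η ω) (q (k ω).unpair.1 + q (k ω).unpair.2)
  have h₂ := dist_add_add_le (ξ ω) (η ω) (q (k ω).unpair.1) (q (k ω).unpair.2)
  linarith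

/-- Selections of a map with closed values form a closed subset of `L^p`. -/
lemma isClosed_lpSelections {Ω : Type*} [MeasurableSpace Ω] (μ : Measure Ω) (p : ℝ≥0∞)
    [Fact (1 ≤ p)] {d : ℕ} {X : Ω → Set (Vec d)} (hX : ∀ ω, IsClosed (X ω)) :
    IsClosed (lpSelections μ p X) := by
  refine IsSeqClosed.isClosed fun u f hu hf => ?_
  obtain ⟨ns, -, h⟩ := (tendstoInMeasure_of_tendsto_Lp hf).exists_seq_tendsto_ae
  filter_upwards [h, ae_all_iff.2 hu] with ω hω huω
  exact (hX ω).mem_of_tendsto hω (Eventually.of_forall fun n => huω _)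

/-- Lemma 2.1: for `p ∈ [1, ∞)` and `p`-integrable random closed sets `𝐗, 𝐘`,
`L^p(𝐗 ⊞ 𝐘) = cl(L^p(𝐗) + L^p(𝐘))`, where `𝐗 ⊞ 𝐘` is the closed sum and the
closure on the right is taken in the `L^p` norm. -/
theorem statement0 {Ω : Type*} [MeasurableSpace Ω] (μ : Measure Ω) [IsProbabilityMeasure μ]
    [μ.IsComplete] {d : ℕ} (p : ℝ≥0∞) [Fact (1 ≤ p)] (hp : p ≠ ∞)
    (X Y : Ω → Set (Vec d))
    (hXm : EffrosMeasurable X) (hYm : EffrosMeasurable Y)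
    (hXne : ∀ ω, (X ω).Nonempty) (hYne : ∀ ω, (Y ω).Nonempty)
    (hXcl : ∀ ω, IsClosed (X ω)) (hYcl : ∀ ω, IsClosed (Y ω))
    (hXsel : (lpSelections μ p X).Nonempty) (hYsel : (lpSelections μ p Y).Nonempty) :
    lpSelections μ p (fun ω => closure (X ω + Y ω)) =
      closure (lpSelections μ p X + lpSelections μ p Y) := by
  classical
  refine Subset.antisymm (fun ζ hζ => ?_)
    (closure_minimal ?_ (isClosed_lpSelections μ p fun _ => isClosed_closure))
  · obtain ⟨ξ₀, hξ₀⟩ := hXsel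
    obtain ⟨η₀, hη₀⟩ := hYsel
    rw [Metric.mem_closure_iff]
    intro ε hε
    obtain ⟨ξ, η, hξm, hηm, hξ, hη, hnear⟩ := exists_measurable_selections_near (μ := μ)
      hXm hYm hXne hYne hXcl hYcl (Lp.stronglyMeasurable ζ).measurable hζ
      (δ := ε / 15) (by positivity)
    let g : Ω → Vec d := fun ω => ζ ω - (ξ₀ ω + η₀ ω)
    have hg : MemLp g p μ := (Lp.memLp ζ).sub ((Lp.memLp ξ₀).add (Lp.memLp η₀))
    obtain ⟨δ, hδ, hgδ⟩ := hg.eLpNorm_indicator_le Fact.out hp (ε := ε / 3) (by positivity)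
    let B : ℕ → Set Ω := fun k => {ω | (k : ℝ) < ‖ξ ω‖ + ‖η ω‖}
    have hBm : ∀ k, MeasurableSet (B k) := fun k =>
      measurableSet_lt measurable_const (hξm.norm.add hηm.norm)
    have hB : Tendsto (μ ∘ B) atTop (nhds 0) := by
      have hempty : ⋂ k, B k = ∅ := by
        refine eq_empty_of_forall_notMem fun ω hω => ?_
        obtain ⟨k, hk⟩ := exists_nat_ge (‖ξ ω‖ + ‖η ω‖)
        exact not_lt.2 hk (mem_iInter.1 hω k)
      rw [← measure_empty (μ := μ), ← hempty]
      exact tendsto_measure_iInter_atTop (fun k => (hBm k).nullMeasurableSet)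
        (fun k l hkl ω (hω : (l : ℝ) < _) => (Nat.cast_le.2 hkl).trans_lt hω)
        ⟨0, measure_ne_top _ _⟩
    obtain ⟨k, hk⟩ := (hB.eventually_lt_const (ENNReal.ofReal_pos.2 hδ)).exists
    have hmem : ∀ (f : Ω → Vec d) (f₀ : Lp (Vec d) p μ), Measurable f →
        (∀ ω ∉ B k, ‖f ω‖ ≤ k) → MemLp ((B k).piecewise f₀ f) p μ := fun f f₀ hf hb =>
      MemLp.piecewise (hBm k) ((Lp.memLp f₀).restrict _) <|
        MemLp.of_bound hf.aestronglyMeasurable k <|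
          (ae_restrict_mem (hBm k).compl).mono hb
    have hξL := hmem ξ ξ₀ hξm fun ω hω => by
      have h : ‖ξ ω‖ + ‖η ω‖ ≤ k := not_lt.1 hω
      linarith [norm_nonneg (η ω)]
    have hηL := hmem η η₀ hηm fun ω hω => by
      have h : ‖ξ ω‖ + ‖η ω‖ ≤ k := not_lt.1 hω
      linarith [norm_nonneg (ξ ω)]
    have hsel : ∀ (Z : Ω → Set (Vec d)) (f : Ω → Vec d) (f₀ : Lp (Vec d) p μ),
        (∀ ω, f ω ∈ Z ω) → f₀ ∈ lpSelections μ p Z →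
        ∀ h : MemLp ((B k).piecewise f₀ f) p μ, h.toLp _ ∈ lpSelections μ p Z := by
      intro Z f f₀ hf hf₀ h
      change ∀ᵐ ω ∂μ, h.toLp _ ω ∈ Z ω
      filter_upwards [h.coeFn_toLp, hf₀] with ω h₁ h₂
      rw [h₁]
      by_cases hω : ω ∈ B k <;> simp [hω, h₂, hf ω]
    refine ⟨_, add_mem_add (hsel X ξ ξ₀ hξ hξ₀ hξL) (hsel Y η η₀ hη hη₀ hηL), ?_⟩
    rw [← ENNReal.ofReal_lt_ofReal_iff hε, ← Lp.edist_dist, Lp.edist_def]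
    have hbound : ∀ᵐ ω ∂μ, ‖(ζ - (hξL.toLp _ + hηL.toLp _ : Lp (Vec d) p μ) : Ω → Vec d) ω‖ ≤
        ‖(ε / 3 : ℝ) + ‖(B k).indicator g ω‖‖ := by
      filter_upwards [Lp.coeFn_add (hξL.toLp _) (hηL.toLp _), hξL.coeFn_toLp, hηL.coeFn_toLp,
        hnear] with ω h₁ h₂ h₃ h₄
      rw [Pi.sub_apply, h₁, Pi.add_apply, h₂, h₃,
        Real.norm_of_nonneg (r := _ + _) (by positivity)]
      by_cases hω : ω ∈ B k
      · simp only [hω, piecewise_eq_of_mem, indicator_of_mem, g]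
        linarith
      · simp only [hω, not_false_eq_true, piecewise_eq_of_notMem, indicator_of_notMem, norm_zero]
        linarith
    calc _ ≤ eLpNorm (fun ω => (ε / 3 : ℝ) + ‖(B k).indicator g ω‖) p μ :=
          eLpNorm_mono_ae hbound
      _ ≤ eLpNorm (fun _ => (ε / 3 : ℝ)) p μ + eLpNorm (fun ω => ‖(B k).indicator g ω‖) p μ :=
          eLpNorm_add_le aestronglyMeasurable_const
            (hg.aestronglyMeasurable.indicator (hBm k)).norm Fact.out
      _ ≤ ENNReal.ofReal (ε / 3) + ENNReal.ofReal (ε / 3) := by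
          gcongr
          · refine (eLpNorm_le_of_ae_bound (C := ε / 3) (Eventually.of_forall fun _ =>
              (Real.norm_of_nonneg (by positivity)).le)).trans ?_
            simp
          · rw [eLpNorm_norm]
            exact hgδ _ (hBm k) hk.le
      _ < ENNReal.ofReal ε := by
          rw [← ENNReal.ofReal_add (by positivity) (by positivity)]
          exact (ENNReal.ofReal_lt_ofReal_iff hε).2 (by linarith)
  · rintro _ ⟨ξ, hξ, η, hη, rfl⟩
    change ∀ᵐ ω ∂μ, (ξ + η : Lp (Vec d) p μ) ω ∈ closure (X ω + Y ω)
    filter_upwards [Lp.coeFn_add ξ η, hξ, hη] with ω h h₁ h₂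
    rw [h]
    exact subset_closure (add_mem_add h₁ h₂)
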